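/- Let κ > 0 be the exponent from the transversality estimate (|{θ : |X(θ)| < αε}| ≤ ε^κ for admissible curves X and 0 ≤ ε < ε₀). For any c > 0, provided the truncation parameter ε₁ ∈ (0, ε₀) is chosen small enough and α is small enough, the following holds for all sufficiently large K: the set E_K(c) = {θ ∈ [0,1)∖Q : ∑_{k=0}^{K} q_k(θ) ≥ cK} has Lebesgue measure at most d^{−κc√K/6}. -/

import Mathlib

open Set MeasureTheory Filter
open scoped ENNReal

noncomputable section

/-- The quadratic map `f(x) = a - x²`. -/
def qm (a : ℝ) : ℝ → ℝ := fun x => a - x ^ 2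

/-- The critical point `0` of `qm a` is strictly pre-periodic: its forward orbit never
returns to `0` and is eventually periodic. -/
def StrictlyPreperiodic (a : ℝ) : Prop :=
  (∀ i : ℕ, 1 ≤ i → (qm a)^[i] 0 ≠ 0) ∧
    ∃ m p : ℕ, 1 ≤ m ∧ 1 ≤ p ∧ (qm a)^[m + p] 0 = (qm a)^[m] 0

/-- A lift of the Viana skew product `F(θ, x) = (dθ, f(x) + αφ(θ))` to `ℝ × ℝ`;
for `φ` of period `1` this is a lift of the corresponding map of `(ℝ/ℤ) × ℝ`. -/
def Viana (a : ℝ) (d : ℕ) (φ : ℝ → ℝ) (α : ℝ) : ℝ × ℝ → ℝ × ℝ :=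
  fun p => ((d : ℝ) * p.1, qm a p.2 + α * φ p.1)

/-- The fibre maps `f_n`, defined by `F^n(θ, x) = (d^n θ, f_n(θ, x))`. -/
def fn (a : ℝ) (d : ℕ) (φ : ℝ → ℝ) (α : ℝ) (n : ℕ) (θ x : ℝ) : ℝ :=
  ((Viana a d φ α)^[n] (θ, x)).2

/-- Endpoints of the shadowing intervals: `IEnd a α n` gives the endpoints of `I_{n+1}`, where
`I₁ = [c₁ - 2α, c₁ + 2α]` and `I_{n+1}` is the closed interval containing `f(I_n)` both of whose
complementary components in `I_{n+1}` have length `α`. -/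
def IEnd (a α : ℝ) : ℕ → ℝ × ℝ
  | 0 => (qm a 0 - 2 * α, qm a 0 + 2 * α)
  | n + 1 =>
      (sInf (qm a '' Set.Icc (IEnd a α n).1 (IEnd a α n).2) - α,
        sSup (qm a '' Set.Icc (IEnd a α n).1 (IEnd a α n).2) + α)

/-- The shadowing interval `I_n`, for `n ≥ 1`. -/
def Iseq (a α : ℝ) (n : ℕ) : Set ℝ := Set.Icc (IEnd a α (n - 1)).1 (IEnd a α (n - 1)).2

/-- The length `|I_{n+1}|` of the shadowing interval `I_{n+1}`. -/
def len (a α : ℝ) (n : ℕ) : ℝ := (IEnd a α n).2 - (IEnd a α n).1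

/-- `N(α)`: the maximal integer `N` such that `|I_n| < ξ₀` for all `1 ≤ n ≤ N` and
`∑_{n=1}^{N} |I_n| ≤ ξ₀`. -/
def Nal (a ξ₀ α : ℝ) : ℕ :=
  sSup {N : ℕ | (∀ n : ℕ, 1 ≤ n → n ≤ N → len a α (n - 1) < ξ₀) ∧
    ∑ n ∈ Finset.range N, len a α n ≤ ξ₀}

/-- A curve `X : [0,1) → B = [-β, β]` is admissible if it is the image of a horizontal curve
under `F^n` for some `n ≥ n₀ + 1`: there are `ω = [j/dⁿ, (j+1)/dⁿ) ∈ 𝒫_n` and `x₀ ∈ B` with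
`X(dⁿθ mod 1) = f_n(θ, x₀)` for all `θ ∈ ω`; equivalently `X(t) = f_n((t+j)/dⁿ, x₀)` on `[0,1)`. -/
def Admissible (a : ℝ) (d : ℕ) (φ : ℝ → ℝ) (α β : ℝ) (n₀ : ℕ) (X : ℝ → ℝ) : Prop :=
  ∃ n : ℕ, n₀ + 1 ≤ n ∧ ∃ j : ℕ, j < d ^ n ∧ ∃ x₀ ∈ Set.Icc (-β) β,
    ∀ θ ∈ Set.Ico (0 : ℝ) 1, X θ = fn a d φ α n ((θ + j) / (d : ℝ) ^ n) x₀

/-- `IsRet … X θ n` holds iff `n = 0` or `n` is a return time of `θ` for the curve `X`: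
there is `θ'` in the same element of the partition `𝒫_n` of `[0,1)` as `θ` with
`|f_n(θ', X(θ'))| ≤ α^{0.6}`. -/
def IsRet (a : ℝ) (d : ℕ) (φ : ℝ → ℝ) (α : ℝ) (X : ℝ → ℝ) (θ : ℝ) (n : ℕ) : Prop :=
  n = 0 ∨ 1 ≤ n ∧ ∃ θ' ∈ Set.Ico (0 : ℝ) 1,
    ⌊θ' * (d : ℝ) ^ n⌋ = ⌊θ * (d : ℝ) ^ n⌋ ∧ |fn a d φ α n θ' (X θ')| ≤ α ^ (0.6 : ℝ)

/-- `n_k(θ)` is defined, i.e. `{0} ∪ {return times of θ}` has more than `k` elements. -/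
def NkDef (a : ℝ) (d : ℕ) (φ : ℝ → ℝ) (α : ℝ) (X : ℝ → ℝ) (θ : ℝ) (k : ℕ) : Prop :=
  {n : ℕ | IsRet a d φ α X θ n}.Infinite ∨ k < {n : ℕ | IsRet a d φ α X θ n}.ncard

/-- `n_k(θ)`: the `k`-th smallest element of `{0} ∪ {return times of θ}` (so `n₀(θ) = 0`). -/
def nk (a : ℝ) (d : ℕ) (φ : ℝ → ℝ) (α : ℝ) (X : ℝ → ℝ) (θ : ℝ) (k : ℕ) : ℕ :=
  Nat.nth (IsRet a d φ α X θ) k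

open Classical in
/-- The truncated return depth `q_k(θ)`: if `n_k(θ)` is defined and `q̂_k(θ)` is the unique
integer with `d^{-q̂+1} α > |f_{n_k(θ)}(θ, X(θ))| ≥ d^{-q̂} α` (namely
`q̂ = ⌈log_d(α / |f_{n_k(θ)}(θ, X(θ))|)⌉`), then `q_k(θ) = q̂_k(θ)` when `d^{-(q̂-1)} < ε₁`,
and `q_k(θ) = 0` otherwise (also when `n_k(θ)` is undefined). -/
def qk (a : ℝ) (d : ℕ) (φ : ℝ → ℝ) (α ε₁ : ℝ) (X : ℝ → ℝ) (θ : ℝ) (k : ℕ) : ℤ :=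
  if NkDef a d φ α X θ k then
    if (d : ℝ) ^ (-(⌈Real.logb d (α / |fn a d φ α (nk a d φ α X θ k) θ (X θ)|)⌉ - 1)) < ε₁ then
      ⌈Real.logb d (α / |fn a d φ α (nk a d φ α X θ k) θ (X θ)|)⌉
    else 0
  else 0

/-! ### Functions constant on `d`-adic cells -/

/-- `u` is constant on the `d`-adic cells `[j/d^m, (j+1)/d^m)` of generation `m`. -/
def CellConst (d m : ℕ) {γ : Type*} (u : ℝ → γ) : Prop :=
  ∀ θ θ' : ℝ, ⌊θ * (d : ℝ) ^ m⌋ = ⌊θ' * (d : ℝ) ^ m⌋ → u θ = u θ'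

theorem floor_cell_mono {d : ℕ} (hd : 2 ≤ d) {m n : ℕ} (hmn : m ≤ n) {θ θ' : ℝ}
    (h : ⌊θ * (d : ℝ) ^ n⌋ = ⌊θ' * (d : ℝ) ^ n⌋) :
    ⌊θ * (d : ℝ) ^ m⌋ = ⌊θ' * (d : ℝ) ^ m⌋ := by
  have key : ∀ t : ℝ, ⌊t * (d : ℝ) ^ m⌋ = ⌊t * (d : ℝ) ^ n⌋ / ((d ^ (n - m) : ℕ) : ℤ) := by
    intro t
    have hd0 : (d : ℝ) ≠ 0 := by positivity
    rw [← Int.floor_div_natCast]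
    congr 1
    obtain ⟨p, rfl⟩ := Nat.exists_eq_add_of_le hmn
    push_cast
    rw [Nat.add_sub_cancel_left, pow_add]
    field_simp
  rw [key, key, h]

theorem CellConst.mono {d : ℕ} (hd : 2 ≤ d) {m n : ℕ} (hmn : m ≤ n) {γ : Type*} {u : ℝ → γ}
    (h : CellConst d m u) : CellConst d n u :=
  fun _ _ hθ => h _ _ (floor_cell_mono hd hmn hθ)

theorem CellConst.eq_comp {d : ℕ} (hd : 2 ≤ d) {m : ℕ} {γ : Type*} {u : ℝ → γ}
    (h : CellConst d m u) :
    u = (fun i : ℤ => u (i / (d : ℝ) ^ m)) ∘ fun θ : ℝ => ⌊θ * (d : ℝ) ^ m⌋ := by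
  have hd0 : (d : ℝ) ≠ 0 := by positivity
  funext θ
  apply h
  rw [div_mul_cancel₀ _ (pow_ne_zero _ hd0), Int.floor_intCast]

theorem measurable_floor_cell (d m : ℕ) : Measurable fun θ : ℝ => ⌊θ * (d : ℝ) ^ m⌋ :=
  Int.measurable_floor.comp (measurable_id.mul_const _)

theorem CellConst.measurable {d : ℕ} (hd : 2 ≤ d) {m : ℕ} {γ : Type*} [MeasurableSpace γ]
    {u : ℝ → γ} (h : CellConst d m u) : Measurable u := by
  rw [h.eq_comp hd]
  exact (measurable_from_top (f := fun i : ℤ => u (i / (d : ℝ) ^ m))).comp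
    (measurable_floor_cell d m)

theorem CellConst.measurableSet {d : ℕ} (hd : 2 ≤ d) {m : ℕ} {A : Set ℝ}
    (h : CellConst d m (· ∈ A)) : MeasurableSet A := by
  have : Measurable (· ∈ A) := h.measurable hd
  exact measurableSet_setOfPred.2 this

/-- If `A` has relative measure at most `ρ` in every cell of generation `m`, then the same bound
holds with respect to every density that is constant on these cells. -/
theorem CellConst.setLIntegral_le {d : ℕ} (hd : 2 ≤ d) {m : ℕ} {μ : Measure ℝ} {A : Set ℝ}
    {ρ : ℝ≥0∞}
    (hA : ∀ i : ℤ, μ ({θ | ⌊θ * (d : ℝ) ^ m⌋ = i} ∩ A) ≤ ρ * μ {θ | ⌊θ * (d : ℝ) ^ m⌋ = i})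
    {u : ℝ → ℝ≥0∞} (hu : CellConst d m u) :
    ∫⁻ θ in A, u θ ∂μ ≤ ρ * ∫⁻ θ, u θ ∂μ := by
  have hmeas := measurable_floor_cell d m
  have key : ∀ ν : Measure ℝ, ∫⁻ θ, u θ ∂ν =
      ∑' i : ℤ, u (i / (d : ℝ) ^ m) * ν {θ | ⌊θ * (d : ℝ) ^ m⌋ = i} := by
    intro ν
    rw [hu.eq_comp hd]
    simp only [Function.comp_def]
    rw [← lintegral_map (f := fun i : ℤ => u (i / (d : ℝ) ^ m)) measurable_from_top hmeas,
      lintegral_countable']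
    congr 1
    funext i
    rw [Measure.map_apply hmeas (measurableSet_singleton i)]
    have hd0 : (d : ℝ) ≠ 0 := by positivity
    rw [div_mul_cancel₀ _ (pow_ne_zero _ hd0), Int.floor_intCast]
    rfl
  rw [key, key, ← ENNReal.tsum_mul_left]
  refine ENNReal.tsum_le_tsum fun i => ?_
  rw [Measure.restrict_apply (show MeasurableSet {θ : ℝ | ⌊θ * (d : ℝ) ^ m⌋ = i} from
    hmeas (measurableSet_singleton i))]
  calc u (i / (d : ℝ) ^ m) * μ ({θ | ⌊θ * (d : ℝ) ^ m⌋ = i} ∩ A)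
      ≤ u (i / (d : ℝ) ^ m) * (ρ * μ {θ | ⌊θ * (d : ℝ) ^ m⌋ = i}) := by gcongr; exact hA i
    _ = _ := by ring

/-! ### Occurrence times -/

open Classical in
/-- The set of `θ` for which the `k`-th time (counted from `0`) at which `R θ` holds is `m`. -/
def occursAt (R : ℝ → ℕ → Prop) (k m : ℕ) : Set ℝ :=
  {θ | R θ m ∧ Nat.count (R θ) m = k}

theorem occursAt_unique {R : ℝ → ℕ → Prop} {k m n : ℕ} {θ : ℝ} (hm : θ ∈ occursAt R k m)
    (hn : θ ∈ occursAt R k n) : m = n := by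
  classical
  exact Nat.count_injective hm.1 hn.1 (hm.2.trans hn.2.symm)

theorem occursAt_gap {R : ℝ → ℕ → Prop} {G : ℕ}
    (hgap : ∀ θ m n, R θ m → R θ n → m < n → m + G ≤ n) {θ : ℝ} {k m : ℕ}
    (hm : θ ∈ occursAt R k m) (M : ℕ) {n : ℕ} (hn : θ ∈ occursAt R (k + M) n) :
    m + G * M ≤ n := by
  classical
  induction M generalizing n with
  | zero => simpa using (occursAt_unique hm hn).le
  | succ M ih =>
    have hlt : k + M < Nat.count (R θ) n := by
      have h : Nat.count (R θ) n = k + (M + 1) := by convert hn.2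
      omega
    have hcard : ∀ hf : (Set.ofPred (R θ)).Finite, k + M < hf.toFinset.card :=
      fun hf => hlt.trans (Nat.count_lt_card hf hn.1)
    have h1 : θ ∈ occursAt R (k + M) (Nat.nth (R θ) (k + M)) :=
      ⟨Nat.nth_mem _ hcard, by convert Nat.count_nth hcard⟩
    have h2 := hgap θ _ _ h1.1 hn.1 (Nat.nth_lt_of_lt_count hlt)
    have h3 := ih h1
    rw [Nat.mul_succ]
    omega

theorem cellConst_occursAt {d : ℕ} (hd : 2 ≤ d) {R : ℝ → ℕ → Prop}
    (hR : ∀ n, CellConst d n (R · n)) (k m : ℕ) : CellConst d m (· ∈ occursAt R k m) := by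
  classical
  intro θ θ' h
  have h1 : ∀ n ≤ m, (R θ n ↔ R θ' n) := fun n hn => iff_of_eq ((hR n).mono hd hn θ θ' h)
  have h2 : Nat.count (R θ) m = Nat.count (R θ') m := by
    rw [Nat.count_eq_card_filter_range, Nat.count_eq_card_filter_range]
    congr 1
    refine Finset.filter_congr fun n hn => h1 n (Finset.mem_range.1 hn).le
  simp only [occursAt, Set.mem_ofPred_eq, eq_iff_iff]
  rw [h1 m le_rfl]
  constructor
  · rintro ⟨h3, h4⟩
    exact ⟨h3, by convert h2.symm.trans (by convert h4)⟩
  · rintro ⟨h3, h4⟩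
    exact ⟨h3, by convert h2.trans (by convert h4)⟩

theorem tsum_indicator_occursAt_le (R : ℝ → ℕ → Prop) (k : ℕ) (u : ℝ → ℝ≥0∞) (θ : ℝ) :
    ∑' m, (occursAt R k m).indicator u θ ≤ u θ := by
  by_cases h : ∃ m, θ ∈ occursAt R k m
  · obtain ⟨m, hm⟩ := h
    rw [tsum_eq_single m]
    · exact Set.indicator_le_self _ _ _
    · intro n hn
      exact Set.indicator_of_notMem (fun h => hn (occursAt_unique h hm)) _
  · push Not at h
    simp [Set.indicator_of_notMem (h _)]

/-! ### Exponential moments of truncated depths -/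

/-- The exponential weight at time `m`: the sum of `wt s` over the levels `s ∈ [s₀, S]` such that
`θ` lies in the set `A m s` of points of depth at least `s` at time `m`. -/
def depthWeight (A : ℕ → ℕ → Set ℝ) (wt : ℕ → ℝ≥0∞) (s₀ S m : ℕ) (θ : ℝ) : ℝ≥0∞ :=
  ∑ s ∈ Finset.Icc s₀ S, (A m s).indicator (fun _ => wt s) θ

/-- One plus the exponential weight of `θ` at the `k`-th occurrence time, if there is one. -/
def occurrenceFactor (R : ℝ → ℕ → Prop) (A : ℕ → ℕ → Set ℝ) (wt : ℕ → ℝ≥0∞) (s₀ S k : ℕ)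
    (θ : ℝ) : ℝ≥0∞ :=
  1 + ∑' m, (occursAt R k m).indicator (depthWeight A wt s₀ S m) θ

section Moment

variable {d : ℕ} {R : ℝ → ℕ → Prop} {A : ℕ → ℕ → Set ℝ} {wt ρ : ℕ → ℝ≥0∞} {s₀ S : ℕ}
  {μ : Measure ℝ}

theorem cellConst_depthWeight (hd : 2 ≤ d) (hAc : ∀ m s, CellConst d (m + s) (· ∈ A m s))
    (m : ℕ) : CellConst d (m + S) (depthWeight A wt s₀ S m) := by
  classical
  intro θ θ' h
  refine Finset.sum_congr rfl fun s hs => ?_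
  have h1 : (θ ∈ A m s ↔ θ' ∈ A m s) := iff_of_eq ((hAc m s).mono hd
    (by have := (Finset.mem_Icc.1 hs).2; omega) θ θ' h)
  by_cases h2 : θ ∈ A m s
  · rw [Set.indicator_of_mem h2, Set.indicator_of_mem (h1.1 h2)]
  · rw [Set.indicator_of_notMem h2, Set.indicator_of_notMem (mt h1.2 h2)]

theorem measurable_occurrenceFactor (hd : 2 ≤ d) (hR : ∀ n, CellConst d n (R · n))
    (hAc : ∀ m s, CellConst d (m + s) (· ∈ A m s)) (k : ℕ) :
    Measurable (occurrenceFactor R A wt s₀ S k) := by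
  have h : ∀ m, Measurable ((occursAt R k m).indicator (depthWeight A wt s₀ S m)) := fun m =>
    ((cellConst_depthWeight hd hAc m).measurable hd).indicator
      ((cellConst_occursAt hd hR k m).measurableSet hd)
  exact measurable_const.add (Measurable.tsum h)

theorem lintegral_mul_depthWeight_le (hd : 2 ≤ d)
    (hAc : ∀ m s, CellConst d (m + s) (· ∈ A m s))
    (hA : ∀ m s, s₀ ≤ s → ∀ i : ℤ, μ ({θ | ⌊θ * (d : ℝ) ^ m⌋ = i} ∩ A m s) ≤
      ρ s * μ {θ | ⌊θ * (d : ℝ) ^ m⌋ = i})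
    {m : ℕ} {u : ℝ → ℝ≥0∞} (hu : CellConst d m u) :
    ∫⁻ θ, u θ * depthWeight A wt s₀ S m θ ∂μ ≤
      (∑ s ∈ Finset.Icc s₀ S, wt s * ρ s) * ∫⁻ θ, u θ ∂μ := by
  have hum := hu.measurable hd
  simp only [depthWeight, Finset.mul_sum]
  rw [lintegral_finsetSum, Finset.sum_mul]
  · refine Finset.sum_le_sum fun s hs => ?_
    have h1 : ∀ θ, u θ * (A m s).indicator (fun _ => wt s) θ =
        (A m s).indicator (fun θ => wt s * u θ) θ := by
      intro θ
      by_cases h : θ ∈ A m s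
      · simp [h, mul_comm]
      · simp [h]
    simp only [h1]
    rw [lintegral_indicator ((hAc m s).measurableSet hd), lintegral_const_mul _ hum, mul_assoc]
    gcongr
    exact hu.setLIntegral_le hd (hA m s (Finset.mem_Icc.1 hs).1)
  · intro s _
    exact hum.mul (measurable_const.indicator ((hAc m s).measurableSet hd))

/-- Along an arithmetic progression of occurrence times, whose gaps exceed the truncation level
`S`, the exponential moments grow at most geometrically. -/
theorem lintegral_prod_occurrenceFactor_le [IsProbabilityMeasure μ] (hd : 2 ≤ d)
    (hR : ∀ n, CellConst d n (R · n)) {G : ℕ}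
    (hgap : ∀ θ m n, R θ m → R θ n → m < n → m + G ≤ n)
    (hAc : ∀ m s, CellConst d (m + s) (· ∈ A m s))
    (hA : ∀ m s, s₀ ≤ s → ∀ i : ℤ, μ ({θ | ⌊θ * (d : ℝ) ^ m⌋ = i} ∩ A m s) ≤
      ρ s * μ {θ | ⌊θ * (d : ℝ) ^ m⌋ = i})
    {M : ℕ} (hS : S ≤ G * M) {δ : ℝ≥0∞} (hδ : ∑ s ∈ Finset.Icc s₀ S, wt s * ρ s ≤ δ)
    (r i : ℕ) :
    ∫⁻ θ, ∏ l ∈ Finset.range i, occurrenceFactor R A wt s₀ S (r + l * M) θ ∂μ ≤ (1 + δ) ^ i := by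
  induction i with
  | zero => simp
  | succ i ih =>
    set H : ℝ → ℝ≥0∞ :=
      fun θ => ∏ l ∈ Finset.range i, occurrenceFactor R A wt s₀ S (r + l * M) θ with hH
    have hHm : Measurable H := Finset.measurable_prod _ fun l _ =>
      measurable_occurrenceFactor hd hR hAc _
    set k := r + i * M with hk
    have hBm : ∀ m, MeasurableSet (occursAt R k m) :=
      fun m => (cellConst_occursAt hd hR k m).measurableSet hd
    have hwm : ∀ m, Measurable (depthWeight A wt s₀ S m) :=
      fun m => (cellConst_depthWeight hd hAc m).measurable hd
    have hcell : ∀ m, CellConst d m ((occursAt R k m).indicator H) := by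
      intro m θ θ' h
      have hiff : (θ ∈ occursAt R k m ↔ θ' ∈ occursAt R k m) :=
        iff_of_eq (cellConst_occursAt hd hR k m θ θ' h)
      by_cases hθ : θ ∈ occursAt R k m
      · rw [Set.indicator_of_mem hθ, Set.indicator_of_mem (hiff.1 hθ)]
        refine Finset.prod_congr rfl fun l hl => ?_
        simp only [occurrenceFactor]
        congr 2
        funext n
        have haux : ∀ t t' : ℝ, ⌊t * (d : ℝ) ^ m⌋ = ⌊t' * (d : ℝ) ^ m⌋ →
            t ∈ occursAt R k m → t ∈ occursAt R (r + l * M) n →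
            t' ∈ occursAt R (r + l * M) n ∧
              depthWeight A wt s₀ S n t = depthWeight A wt s₀ S n t' := by
          intro t t' htt ht htn
          obtain ⟨j, hj⟩ := Nat.exists_eq_add_of_lt (Finset.mem_range.1 hl)
          have hkl : k = (r + l * M) + (j + 1) * M := by rw [hk, hj]; ring
          have h1 := occursAt_gap hgap htn ((j + 1) * M) (hkl ▸ ht)
          have h2 : S ≤ G * ((j + 1) * M) := hS.trans
            (Nat.mul_le_mul_left _ (Nat.le_mul_of_pos_left _ (Nat.succ_pos j)))
          refine ⟨?_, cellConst_depthWeight hd hAc n t t' (floor_cell_mono hd (by omega) htt)⟩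
          exact (iff_of_eq (cellConst_occursAt hd hR _ n t t'
            (floor_cell_mono hd (by omega) htt))).1 htn
        by_cases h1 : θ ∈ occursAt R (r + l * M) n
        · obtain ⟨h2, h3⟩ := haux θ θ' h hθ h1
          rw [Set.indicator_of_mem h1, Set.indicator_of_mem h2, h3]
        · have h2 : θ' ∉ occursAt R (r + l * M) n :=
            fun h2 => h1 (haux θ' θ h.symm (hiff.1 hθ) h2).1
          rw [Set.indicator_of_notMem h1, Set.indicator_of_notMem h2]
      · rw [Set.indicator_of_notMem hθ, Set.indicator_of_notMem (mt hiff.2 hθ)]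
    have hsplit : ∀ θ, ∏ l ∈ Finset.range (i + 1), occurrenceFactor R A wt s₀ S (r + l * M) θ =
        H θ + ∑' m, (occursAt R k m).indicator H θ * depthWeight A wt s₀ S m θ := by
      intro θ
      rw [Finset.prod_range_succ, occurrenceFactor, mul_add, mul_one, ← ENNReal.tsum_mul_left]
      congr 2
      funext m
      by_cases h : θ ∈ occursAt R k m
      · rw [Set.indicator_of_mem h, Set.indicator_of_mem h]
      · rw [Set.indicator_of_notMem h, Set.indicator_of_notMem h, mul_zero, zero_mul]
    simp only [hsplit]
    rw [lintegral_add_left hHm, lintegral_tsum (f := fun m θ =>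
      (occursAt R k m).indicator H θ * depthWeight A wt s₀ S m θ) fun m =>
      ((hHm.indicator (hBm m)).mul (hwm m)).aemeasurable]
    calc ∫⁻ θ, H θ ∂μ +
          ∑' m, ∫⁻ θ, (occursAt R k m).indicator H θ * depthWeight A wt s₀ S m θ ∂μ
        ≤ ∫⁻ θ, H θ ∂μ + ∑' m, δ * ∫⁻ θ, (occursAt R k m).indicator H θ ∂μ := by
          gcongr with m
          refine (lintegral_mul_depthWeight_le hd hAc hA (hcell m)).trans ?_
          gcongr
      _ = ∫⁻ θ, H θ ∂μ + δ * ∫⁻ θ, ∑' m, (occursAt R k m).indicator H θ ∂μ := by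
          rw [ENNReal.tsum_mul_left, lintegral_tsum fun m =>
            (hHm.indicator (hBm m)).aemeasurable]
      _ ≤ ∫⁻ θ, H θ ∂μ + δ * ∫⁻ θ, H θ ∂μ := by
          gcongr with θ
          exact tsum_indicator_occursAt_le R k H θ
      _ = (1 + δ) * ∫⁻ θ, H θ ∂μ := by ring
      _ ≤ (1 + δ) * (1 + δ) ^ i := by gcongr
      _ = (1 + δ) ^ (i + 1) := by ring

theorem measure_deep_occurrence_le [IsProbabilityMeasure μ] (hd : 2 ≤ d)
    (hR : ∀ n, CellConst d n (R · n))
    (hA : ∀ m s, s₀ ≤ s → ∀ i : ℤ, μ ({θ | ⌊θ * (d : ℝ) ^ m⌋ = i} ∩ A m s) ≤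
      ρ s * μ {θ | ⌊θ * (d : ℝ) ^ m⌋ = i}) {s : ℕ} (hs : s₀ ≤ s) (k : ℕ) :
    μ {θ | ∃ m, θ ∈ occursAt R k m ∧ θ ∈ A m s} ≤ ρ s := by
  have hBm : ∀ m, MeasurableSet (occursAt R k m) :=
    fun m => (cellConst_occursAt hd hR k m).measurableSet hd
  have hcell : ∀ m, CellConst d m ((occursAt R k m).indicator fun _ => (1 : ℝ≥0∞)) := by
    intro m θ θ' h
    have hiff : (θ ∈ occursAt R k m ↔ θ' ∈ occursAt R k m) :=
      iff_of_eq (cellConst_occursAt hd hR k m θ θ' h)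
    by_cases hθ : θ ∈ occursAt R k m
    · rw [Set.indicator_of_mem hθ, Set.indicator_of_mem (hiff.1 hθ)]
    · rw [Set.indicator_of_notMem hθ, Set.indicator_of_notMem (mt hiff.2 hθ)]
  calc μ {θ | ∃ m, θ ∈ occursAt R k m ∧ θ ∈ A m s}
      ≤ μ (⋃ m, occursAt R k m ∩ A m s) := by
        refine measure_mono ?_
        rintro θ ⟨m, h1, h2⟩
        exact Set.mem_iUnion.2 ⟨m, h1, h2⟩
    _ ≤ ∑' m, μ (occursAt R k m ∩ A m s) := measure_iUnion_le _
    _ ≤ ∑' m, ρ s * ∫⁻ θ, (occursAt R k m).indicator (fun _ => (1 : ℝ≥0∞)) θ ∂μ := by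
        refine ENNReal.tsum_le_tsum fun m => ?_
        refine le_trans ?_ ((hcell m).setLIntegral_le hd (hA m s hs))
        rw [lintegral_indicator (hBm m), lintegral_one, Measure.restrict_apply_univ,
          Measure.restrict_apply (hBm m)]
    _ = ρ s * ∫⁻ θ, ∑' m, (occursAt R k m).indicator (fun _ => (1 : ℝ≥0∞)) θ ∂μ := by
        rw [ENNReal.tsum_mul_left, lintegral_tsum fun m =>
          (measurable_const.indicator (hBm m)).aemeasurable]
    _ ≤ ρ s * ∫⁻ _, 1 ∂μ := by
        gcongr with θ
        exact tsum_indicator_occursAt_le R k (fun _ => 1) θ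
    _ = ρ s := by simp

end Moment

theorem sum_range_mul_self_eq {γ : Type*} [AddCommMonoid γ] (f : ℕ → γ) (M I : ℕ) :
    ∑ k ∈ Finset.range (I * M), f k =
      ∑ r ∈ Finset.range M, ∑ l ∈ Finset.range I, f (r + l * M) := by
  rw [Finset.sum_comm]
  induction I with
  | zero => simp
  | succ I ih =>
    rw [Nat.succ_mul, Finset.sum_range_add, ih, Finset.sum_range_succ]
    simp only [add_comm]

/-- Large deviations for the sum of the depths `q θ k`: discard the depths exceeding the
truncation level `S`, split the indices into residue classes modulo `M` and apply the Markov
inequality in each class. -/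
theorem measure_depth_sum_le {d : ℕ} {R : ℝ → ℕ → Prop} {A : ℕ → ℕ → Set ℝ} {ρ : ℕ → ℝ≥0∞}
    {s₀ S : ℕ} {μ : Measure ℝ} [IsProbabilityMeasure μ] (hd : 2 ≤ d)
    (hR : ∀ n, CellConst d n (R · n)) {G : ℕ}
    (hgap : ∀ θ m n, R θ m → R θ n → m < n → m + G ≤ n)
    (hAc : ∀ m s, CellConst d (m + s) (· ∈ A m s))
    (hA : ∀ m s, s₀ ≤ s → ∀ i : ℤ, μ ({θ | ⌊θ * (d : ℝ) ^ m⌋ = i} ∩ A m s) ≤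
      ρ s * μ {θ | ⌊θ * (d : ℝ) ^ m⌋ = i})
    {σ : ℝ} (hσ : 0 ≤ σ) {M : ℕ} (hM : 0 < M) (hS : S ≤ G * M) (hs₀S : s₀ ≤ S + 1) {δ : ℝ≥0∞}
    (hδ : ∑ s ∈ Finset.Icc s₀ S, ENNReal.ofReal ((d : ℝ) ^ (σ * s)) * ρ s ≤ δ)
    {E : Set ℝ} {q : ℝ → ℕ → ℕ}
    (hq : ∀ θ ∈ E, ∀ k, q θ k = 0 ∨
      ∃ m, θ ∈ occursAt R k m ∧ s₀ ≤ q θ k ∧ ∀ s ≤ q θ k, θ ∈ A m s) (b : ℝ) :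
    μ {θ | θ ∈ E ∧ b ≤ ((∑ k ∈ Finset.range (M * M), q θ k : ℕ) : ℝ)} ≤
      ((M * M : ℕ) : ℝ≥0∞) * ρ (S + 1) +
        (M : ℝ≥0∞) * ((1 + δ) ^ M / ENNReal.ofReal ((d : ℝ) ^ (σ * (b / M)))) := by
  have hd1 : (1 : ℝ) ≤ d := by exact_mod_cast (by omega : 1 ≤ d)
  have hd0 : (0 : ℝ) < d := by linarith
  set wt : ℕ → ℝ≥0∞ := fun s => ENNReal.ofReal ((d : ℝ) ^ (σ * s)) with hwt
  set Bd : ℕ → Set ℝ := fun k => {θ | ∃ m, θ ∈ occursAt R k m ∧ θ ∈ A m (S + 1)} with hBd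
  set H : ℕ → ℝ → ℝ≥0∞ := fun r θ =>
    ∏ l ∈ Finset.range M, occurrenceFactor R A wt s₀ S (r + l * M) θ with hH
  set y : ℝ≥0∞ := ENNReal.ofReal ((d : ℝ) ^ (σ * (b / M))) with hy
  have hfactor : ∀ θ ∈ E, ∀ k, θ ∉ Bd k → wt (q θ k) ≤ occurrenceFactor R A wt s₀ S k θ := by
    intro θ hθ k hk
    rcases hq θ hθ k with h | ⟨m, hm, h1, h2⟩
    · rw [h]
      simp [wt, occurrenceFactor]
    · have h3 : q θ k ≤ S := by
        by_contra hlt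
        exact hk ⟨m, hm, h2 _ (by omega)⟩
      calc wt (q θ k) = (A m (q θ k)).indicator (fun _ => wt (q θ k)) θ := by
            rw [Set.indicator_of_mem (h2 _ le_rfl)]
        _ ≤ depthWeight A wt s₀ S m θ :=
            Finset.single_le_sum (f := fun s => (A m s).indicator (fun _ => wt s) θ)
              (fun _ _ => zero_le) (Finset.mem_Icc.2 ⟨h1, h3⟩)
        _ = (occursAt R k m).indicator (depthWeight A wt s₀ S m) θ := by
            rw [Set.indicator_of_mem hm]
        _ ≤ ∑' m, (occursAt R k m).indicator (depthWeight A wt s₀ S m) θ := ENNReal.le_tsum m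
        _ ≤ occurrenceFactor R A wt s₀ S k θ := le_add_self
  have hsub : {θ | θ ∈ E ∧ b ≤ ((∑ k ∈ Finset.range (M * M), q θ k : ℕ) : ℝ)} ⊆
      (⋃ k ∈ Finset.range (M * M), Bd k) ∪ ⋃ r ∈ Finset.range M, {θ | y ≤ H r θ} := by
    rintro θ ⟨hθ, hb⟩
    by_cases hbad : ∃ k ∈ Finset.range (M * M), θ ∈ Bd k
    · left
      obtain ⟨k, hk, hk'⟩ := hbad
      exact Set.mem_biUnion hk hk'
    right
    push Not at hbad
    rw [sum_range_mul_self_eq, Nat.cast_sum] at hb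
    have hM0 : (0 : ℝ) < M := by exact_mod_cast hM
    obtain ⟨r, hr, hr'⟩ : ∃ r ∈ Finset.range M,
        b / M ≤ ((∑ l ∈ Finset.range M, q θ (r + l * M) : ℕ) : ℝ) := by
      apply Finset.exists_le_of_sum_le (Finset.nonempty_range_iff.2 hM.ne')
      rw [Finset.sum_const, Finset.card_range, nsmul_eq_mul, mul_div_cancel₀ _ hM0.ne']
      exact hb
    refine Set.mem_biUnion hr ?_
    change y ≤ H r θ
    calc y ≤ ENNReal.ofReal ((d : ℝ) ^ (∑ l ∈ Finset.range M, σ * (q θ (r + l * M) : ℝ))) := by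
          rw [← Finset.mul_sum, hy]
          refine ENNReal.ofReal_le_ofReal (Real.rpow_le_rpow_of_exponent_le hd1 ?_)
          gcongr
          exact_mod_cast hr'
      _ = ∏ l ∈ Finset.range M, wt (q θ (r + l * M)) := by
          rw [Real.rpow_sum_of_pos hd0, ENNReal.ofReal_prod_of_nonneg fun _ _ => by positivity]
      _ ≤ H r θ := by
          refine Finset.prod_le_prod' fun l hl => hfactor θ hθ _ (hbad _ ?_)
          rw [Finset.mem_range] at *
          calc r + l * M < M + l * M := by omega
            _ = (l + 1) * M := by ring
            _ ≤ M * M := by gcongr; omega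
  have hHm : ∀ r, Measurable (H r) := fun r => Finset.measurable_prod _ fun l _ =>
    measurable_occurrenceFactor hd hR hAc _
  refine (measure_mono hsub).trans ((measure_union_le _ _).trans (add_le_add ?_ ?_))
  · refine (measure_biUnion_finset_le _ _).trans ?_
    refine (Finset.sum_le_sum fun k _ =>
      measure_deep_occurrence_le hd hR hA (hs₀S) k).trans ?_
    simp
  · refine (measure_biUnion_finset_le _ _).trans ?_
    refine (Finset.sum_le_sum (g := fun _ => (1 + δ) ^ M / y) fun r _ => ?_).trans ?_
    · refine (meas_ge_le_lintegral_div (hHm r).aemeasurable ?_ ENNReal.ofReal_ne_top).trans ?_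
      · rw [Ne, ENNReal.ofReal_eq_zero, not_le]
        positivity
      · gcongr
        exact lintegral_prod_occurrenceFactor_le hd hR hgap hAc hA hS hδ r M
    · simp

/-! ### Fibre dynamics -/

theorem fn_zero (a : ℝ) (d : ℕ) (φ : ℝ → ℝ) (α θ x : ℝ) : fn a d φ α 0 θ x = x := rfl

theorem viana_iterate_fst (a : ℝ) (d : ℕ) (φ : ℝ → ℝ) (α : ℝ) (n : ℕ) (p : ℝ × ℝ) :
    ((Viana a d φ α)^[n] p).1 = (d : ℝ) ^ n * p.1 := by
  induction n with
  | zero => simp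
  | succ n ih =>
    rw [Function.iterate_succ_apply', Viana, ih]
    ring

theorem fn_succ (a : ℝ) (d : ℕ) (φ : ℝ → ℝ) (α : ℝ) (n : ℕ) (θ x : ℝ) :
    fn a d φ α (n + 1) θ x = qm a (fn a d φ α n θ x) + α * φ ((d : ℝ) ^ n * θ) := by
  rw [fn, Function.iterate_succ_apply']
  simp only [Viana]
  rw [viana_iterate_fst]
  rfl

theorem fn_add (a : ℝ) (d : ℕ) (φ : ℝ → ℝ) (α : ℝ) (m n : ℕ) (θ x : ℝ) :
    fn a d φ α (m + n) θ x = fn a d φ α m ((d : ℝ) ^ n * θ) (fn a d φ α n θ x) := by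
  induction m with
  | zero => simp [fn_zero]
  | succ m ih => rw [Nat.succ_add, fn_succ, fn_succ, ih, pow_add, mul_assoc]

theorem fn_add_intCast (a : ℝ) (d : ℕ) {φ : ℝ → ℝ} (hφp : Function.Periodic φ 1) (α : ℝ)
    (n : ℕ) (θ x : ℝ) (z : ℤ) : fn a d φ α n (θ + z) x = fn a d φ α n θ x := by
  induction n with
  | zero => rfl
  | succ n ih =>
    rw [fn_succ, fn_succ, ih, mul_add]
    have h : (d : ℝ) ^ n * (z : ℝ) = (((d : ℤ) ^ n * z : ℤ) : ℝ) * 1 := by push_cast; ring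
    rw [h, hφp.int_mul]

theorem fn_mem {a : ℝ} {d : ℕ} {φ : ℝ → ℝ} {α β : ℝ}
    (hB : ∀ x ∈ Set.Icc (-β) β, ∀ θ, qm a x + α * φ θ ∈ Set.Icc (-β) β) (n : ℕ) (θ : ℝ) {x : ℝ}
    (hx : x ∈ Set.Icc (-β) β) : fn a d φ α n θ x ∈ Set.Icc (-β) β := by
  induction n with
  | zero => exact hx
  | succ n ih => rw [fn_succ]; exact hB _ ih _

theorem differentiable_fn (a : ℝ) (d : ℕ) (φ : ℝ → ℝ) (α : ℝ) (n : ℕ) (θ : ℝ) :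
    Differentiable ℝ fun y => fn a d φ α n θ y := by
  induction n with
  | zero => exact differentiable_id
  | succ n ih =>
    simp only [fn_succ, qm]
    exact ((differentiable_const a).sub (ih.pow 2)).add_const _

/-- For small `α` the interval `[-β, β]` is invariant under all fibre maps. -/
theorem exists_forall_mapsTo_Icc {a β : ℝ} {φ : ℝ → ℝ} (hβ : 0 ≤ β)
    (hβmap : ∀ x ∈ Set.Icc (-β) β, qm a x ∈ Set.Ioo (-β) β) (hφb : ∀ θ, |φ θ| ≤ 1) :
    ∃ α₁ > 0, ∀ α, 0 < α → α < α₁ →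
      ∀ x ∈ Set.Icc (-β) β, ∀ θ, qm a x + α * φ θ ∈ Set.Icc (-β) β := by
  have hcont : ContinuousOn (fun x => |qm a x|) (Set.Icc (-β) β) := by
    unfold qm; fun_prop
  obtain ⟨x₀, hx₀, hmax⟩ := isCompact_Icc.exists_isMaxOn
    (⟨0, by constructor <;> linarith⟩ : (Set.Icc (-β) β).Nonempty) hcont
  refine ⟨β - |qm a x₀|, sub_pos.2 (abs_lt.2 (hβmap x₀ hx₀)), fun α hα hα1 x hx θ => ?_⟩
  rw [Set.mem_Icc, ← abs_le]
  have h1 : |qm a x| ≤ |qm a x₀| := hmax hx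
  have h2 : |α * φ θ| ≤ α := by
    rw [abs_mul, abs_of_pos hα]
    exact mul_le_of_le_one_right hα.le (hφb θ)
  linarith [abs_add_le (qm a x) (α * φ θ)]

/-- A periodic real-analytic function is Lipschitz. -/
theorem exists_lipschitz_of_periodic {φ : ℝ → ℝ} (hφa : ∀ x : ℝ, AnalyticAt ℝ φ x)
    (hφp : Function.Periodic φ 1) : ∃ L > 0, ∀ x y, |φ x - φ y| ≤ L * |x - y| := by
  have hcont : Continuous (deriv φ) := continuous_iff_continuousAt.2 fun x =>
    (hφa x).deriv.continuousAt
  obtain ⟨L, hL⟩ := isCompact_Icc.exists_bound_of_continuousOn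
    (hcont.continuousOn (s := Set.Icc (0 : ℝ) 1))
  have hper : Function.Periodic (deriv φ) 1 := by
    intro x
    rw [← deriv_comp_add_const]
    congr 1
    funext y
    exact hφp y
  have hbd : ∀ x, ‖deriv φ x‖ ≤ L := by
    intro x
    obtain ⟨y, hy, hxy⟩ := hper.exists_mem_Ico₀ one_pos x
    rw [hxy]
    exact hL y ⟨hy.1, hy.2.le⟩
  refine ⟨max L 1, by positivity, fun x y => ?_⟩
  refine (Convex.norm_image_sub_le_of_norm_deriv_le (fun z _ => (hφa z).differentiableAt)
    (fun z _ => hbd z) convex_univ (Set.mem_univ y) (Set.mem_univ x)).trans ?_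
  rw [Real.norm_eq_abs]
  gcongr
  exact le_max_left _ _

theorem abs_fn_sub_le {a : ℝ} {d : ℕ} {φ : ℝ → ℝ} {α β L C R : ℝ} (hα : 0 ≤ α)
    (hC : 0 ≤ C) (hR : 0 ≤ R)
    (hB : ∀ x ∈ Set.Icc (-β) β, ∀ θ, qm a x + α * φ θ ∈ Set.Icc (-β) β)
    (hφL : ∀ x y, |φ x - φ y| ≤ L * |x - y|)
    (hder : ∀ θ x : ℝ, x ∈ Set.Icc (-β) β → ∀ k : ℕ,
      |deriv (fun y => fn a d φ α k θ y) x| ≤ C * R ^ k)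
    (n : ℕ) {θ θ' x : ℝ} (hx : x ∈ Set.Icc (-β) β) :
    |fn a d φ α n θ x - fn a d φ α n θ' x| ≤
      α * L * C * |θ - θ'| * ∑ i ∈ Finset.range n, (d : ℝ) ^ i * R ^ (n - 1 - i) := by
  have key : ∀ j ≤ n, |fn a d φ α (n - j) ((d : ℝ) ^ j * θ') (fn a d φ α j θ x) -
      fn a d φ α n θ' x| ≤
      α * L * C * |θ - θ'| * ∑ i ∈ Finset.range j, (d : ℝ) ^ i * R ^ (n - 1 - i) := by
    intro j
    induction j with
    | zero => intro _; simp [fn_zero]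
    | succ j ih =>
      intro hj
      obtain ⟨p, rfl⟩ := Nat.exists_eq_add_of_le hj
      have ih := ih (by omega)
      have e1 : j + 1 + p - (j + 1) = p := by omega
      have e2 : j + 1 + p - j = p + 1 := by omega
      have e3 : j + 1 + p - 1 - j = p := by omega
      rw [e2] at ih
      rw [e1, Finset.sum_range_succ, mul_add, e3]
      have hmem1 := fn_mem (d := d) (φ := φ) hB j θ hx
      set u := fn a d φ α j θ x with hu
      have h1 : fn a d φ α (p + 1) ((d : ℝ) ^ j * θ') u =
          fn a d φ α p ((d : ℝ) ^ (j + 1) * θ') (qm a u + α * φ ((d : ℝ) ^ j * θ')) := by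
        rw [fn_add, fn_succ, fn_zero, pow_zero, one_mul, pow_one, pow_succ']
        congr 1
        ring
      rw [h1] at ih
      have h2 : |fn a d φ α p ((d : ℝ) ^ (j + 1) * θ') (qm a u + α * φ ((d : ℝ) ^ j * θ)) -
          fn a d φ α p ((d : ℝ) ^ (j + 1) * θ') (qm a u + α * φ ((d : ℝ) ^ j * θ'))| ≤
          C * R ^ p * |(qm a u + α * φ ((d : ℝ) ^ j * θ)) -
            (qm a u + α * φ ((d : ℝ) ^ j * θ'))| :=
        Convex.norm_image_sub_le_of_norm_deriv_le
          (f := fun y => fn a d φ α p ((d : ℝ) ^ (j + 1) * θ') y)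
          (fun y _ => (differentiable_fn a d φ α p _).differentiableAt)
          (fun y hy => hder _ y hy p) (convex_Icc (-β) β) (hB u hmem1 _) (hB u hmem1 _)
      have h3 : |(qm a u + α * φ ((d : ℝ) ^ j * θ)) - (qm a u + α * φ ((d : ℝ) ^ j * θ'))| ≤
          α * (L * ((d : ℝ) ^ j * |θ - θ'|)) := by
        rw [add_sub_add_left_eq_sub, ← mul_sub, abs_mul, abs_of_nonneg hα]
        gcongr
        refine (hφL _ _).trans (le_of_eq ?_)
        rw [← mul_sub, abs_mul, abs_of_nonneg (by positivity)]
      have h4 := h2.trans (mul_le_mul_of_nonneg_left h3 (by positivity))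
      rw [fn_succ, ← hu]
      refine (abs_sub_le _ _ _).trans ((add_le_add h4 ih).trans (le_of_eq ?_))
      ring
  have h := key n le_rfl
  rwa [Nat.sub_self, fn_zero] at h

theorem sum_pow_mul_pow_le {D R : ℝ} (hR : 0 ≤ R) (hRD : R < D) (n : ℕ) :
    ∑ i ∈ Finset.range n, D ^ i * R ^ (n - 1 - i) ≤ D ^ n / (D - R) := by
  have h := (Commute.all D R).geom_sum₂_mul n
  rw [le_div_iff₀ (sub_pos.2 hRD), h]
  linarith [pow_nonneg hR n]

/-! ### Admissible curves -/

/-- For small `α`, admissible curves are Lipschitz with constant `O(α)`. -/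
theorem exists_admissible_lipschitz {a : ℝ} {d : ℕ} (hd : 2 ≤ d) {φ : ℝ → ℝ}
    (hφa : ∀ x : ℝ, AnalyticAt ℝ φ x) (hφp : Function.Periodic φ 1) (hφb : ∀ θ, |φ θ| ≤ 1)
    {β : ℝ} (hβ : 0 ≤ β) (hβmap : ∀ x ∈ Set.Icc (-β) β, qm a x ∈ Set.Ioo (-β) β) (n₀ : ℕ)
    {C₁ R₁ α₁ : ℝ} (hC₁ : 0 < C₁) (hR₁ : R₁ ∈ Set.Ioo (0 : ℝ) 2) (hα₁ : 0 < α₁)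
    (hder : ∀ α : ℝ, 0 < α → α < α₁ → ∀ θ x : ℝ, x ∈ Set.Icc (-β) β → ∀ k : ℕ,
      |deriv (fun y => fn a d φ α k θ y) x| ≤ C₁ * R₁ ^ k) :
    ∃ C > 0, ∃ α₂ > 0, ∀ α, 0 < α → α < α₂ → ∀ X, Admissible a d φ α β n₀ X →
      ∀ t ∈ Set.Ico (0 : ℝ) 1, ∀ t' ∈ Set.Ico (0 : ℝ) 1, |X t - X t'| ≤ α * C * |t - t'| := by
  obtain ⟨L, hL0, hL⟩ := exists_lipschitz_of_periodic hφa hφp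
  obtain ⟨α₃, hα₃, hB⟩ := exists_forall_mapsTo_Icc hβ hβmap hφb
  have hd2 : (2 : ℝ) ≤ d := by exact_mod_cast hd
  have hRd : R₁ < d := hR₁.2.trans_le hd2
  have hRd' : 0 < (d : ℝ) - R₁ := sub_pos.2 hRd
  refine ⟨L * C₁ / (d - R₁), by positivity, min α₁ α₃, lt_min hα₁ hα₃, ?_⟩
  rintro α hα hαlt X ⟨n, -, j, -, x₀, hx₀, hX⟩ t ht t' ht'
  have hdn : (0 : ℝ) < (d : ℝ) ^ n := by positivity
  rw [hX t ht, hX t' ht']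
  refine (abs_fn_sub_le hα.le hC₁.le hR₁.1.le (hB α hα (hαlt.trans_le (min_le_right _ _)))
    hL (hder α hα (hαlt.trans_le (min_le_left _ _))) n hx₀).trans ?_
  have h1 : |(t + j) / (d : ℝ) ^ n - (t' + j) / (d : ℝ) ^ n| = |t - t'| / (d : ℝ) ^ n := by
    rw [← sub_div, add_sub_add_right_eq_sub, abs_div, abs_of_pos hdn]
  rw [h1]
  refine (mul_le_mul_of_nonneg_left (sum_pow_mul_pow_le hR₁.1.le hRd n) (by positivity)).trans
    (le_of_eq ?_)
  field_simp

/-- The image under `F^m` of the part of an admissible curve over an element of `𝒫_m` is again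
admissible. -/
theorem Admissible.image {a : ℝ} {d : ℕ} (hd : 2 ≤ d) {φ : ℝ → ℝ}
    (hφp : Function.Periodic φ 1) {α β : ℝ} {n₀ : ℕ} {X : ℝ → ℝ}
    (hX : Admissible a d φ α β n₀ X) {m i : ℕ} (hi : i < d ^ m) :
    Admissible a d φ α β n₀
      fun t => fn a d φ α m ((t + i) / (d : ℝ) ^ m) (X ((t + i) / (d : ℝ) ^ m)) := by
  obtain ⟨n, hn, j, hj, x₀, hx₀, hXe⟩ := hX
  have hd0 : (d : ℝ) ≠ 0 := by positivity
  refine ⟨m + n, by omega, i + j * d ^ m, ?_, x₀, hx₀, fun t ht => ?_⟩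
  · calc i + j * d ^ m < d ^ m + j * d ^ m := by omega
      _ = (j + 1) * d ^ m := by ring
      _ ≤ d ^ n * d ^ m := by gcongr; omega
      _ = d ^ (m + n) := by ring
  · have hmem : (t + i) / (d : ℝ) ^ m ∈ Set.Ico (0 : ℝ) 1 := by
      have h1 : (i : ℝ) + 1 ≤ (d : ℝ) ^ m := by exact_mod_cast hi
      have hpos : (0 : ℝ) < (d : ℝ) ^ m := by positivity
      have := ht.1
      refine ⟨by positivity, (div_lt_one hpos).2 (by linarith [ht.2])⟩
    simp only
    rw [hXe _ hmem, fn_add]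
    have h1 : (t + ((i + j * d ^ m : ℕ) : ℝ)) / (d : ℝ) ^ (m + n) =
        ((t + i) / (d : ℝ) ^ m + j) / (d : ℝ) ^ n := by
      push_cast
      rw [pow_add]
      field_simp
      ring
    have h2 : (d : ℝ) ^ n * (((t + i) / (d : ℝ) ^ m + j) / (d : ℝ) ^ n) =
        (t + i) / (d : ℝ) ^ m + ((j : ℤ) : ℝ) := by
      rw [mul_div_cancel₀ _ (pow_ne_zero _ hd0)]
      push_cast
      rfl
    rw [h1, h2, fn_add_intCast a d hφp]

theorem exists_cell_index {d : ℕ} (hd : 2 ≤ d) (m : ℕ) {θ : ℝ} (hθ : θ ∈ Set.Ico (0 : ℝ) 1) :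
    ∃ i : ℕ, i < d ^ m ∧ ⌊θ * (d : ℝ) ^ m⌋ = (i : ℤ) ∧
      θ * (d : ℝ) ^ m - i ∈ Set.Ico (0 : ℝ) 1 := by
  have hpos : (0 : ℝ) < (d : ℝ) ^ m := by positivity
  have h0 : 0 ≤ θ * (d : ℝ) ^ m := mul_nonneg hθ.1 hpos.le
  refine ⟨⌊θ * (d : ℝ) ^ m⌋₊, ?_, (Int.natCast_floor_eq_floor h0).symm, ?_, ?_⟩
  · have h1 : θ * (d : ℝ) ^ m < ((d ^ m : ℕ) : ℝ) := by
      push_cast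
      nlinarith [hθ.2]
    exact (Nat.floor_lt h0).2 h1
  · exact sub_nonneg.2 (Nat.floor_le h0)
  · linarith [Nat.lt_floor_add_one (θ * (d : ℝ) ^ m)]

/-- Over a cell of generation `m + s`, the `m`-th iterate of an admissible curve oscillates by
at most `O(α d^{-s})`. -/
theorem abs_iterate_sub_le {a : ℝ} {d : ℕ} (hd : 2 ≤ d) {φ : ℝ → ℝ}
    (hφp : Function.Periodic φ 1) {α β C : ℝ} (hα : 0 ≤ α) (hC : 0 ≤ C) {n₀ : ℕ}
    (hlip : ∀ X, Admissible a d φ α β n₀ X → ∀ t ∈ Set.Ico (0 : ℝ) 1, ∀ t' ∈ Set.Ico (0 : ℝ) 1,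
      |X t - X t'| ≤ α * C * |t - t'|)
    {X : ℝ → ℝ} (hX : Admissible a d φ α β n₀ X) (m s : ℕ) {θ θ' : ℝ}
    (hθ : θ ∈ Set.Ico (0 : ℝ) 1) (hθ' : θ' ∈ Set.Ico (0 : ℝ) 1)
    (h : ⌊θ * (d : ℝ) ^ (m + s)⌋ = ⌊θ' * (d : ℝ) ^ (m + s)⌋) :
    |fn a d φ α m θ (X θ) - fn a d φ α m θ' (X θ')| ≤ α * (C / (d : ℝ) ^ s) := by
  have hd0 : (d : ℝ) ≠ 0 := by positivity
  have hs : (0 : ℝ) < (d : ℝ) ^ s := by positivity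
  obtain ⟨i, hi, hfl, hmem⟩ := exists_cell_index hd m hθ
  obtain ⟨i', -, hfl', hmem'⟩ := exists_cell_index hd m hθ'
  have hii : i' = i := by
    exact_mod_cast (hfl'.symm.trans ((floor_cell_mono hd (by omega) h).symm.trans hfl))
  rw [hii] at hmem'
  have key := hlip _ (hX.image hd hφp hi) _ hmem _ hmem'
  simp only [sub_add_cancel, mul_div_cancel_right₀ _ (pow_ne_zero m hd0)] at key
  refine key.trans ?_
  rw [mul_assoc]
  gcongr
  rw [div_eq_mul_inv]
  gcongr
  rw [← one_div, le_div_iff₀ hs]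
  have h1 := (Int.abs_sub_lt_one_of_floor_eq_floor h).le
  refine le_trans (le_of_eq ?_) h1
  rw [← abs_of_pos hs, ← abs_mul, pow_add]
  congr 1
  ring

/-- Neighbours of the critical point shadow the critical orbit for a fixed number of steps. -/
theorem exists_shadowing (a : ℝ) (d : ℕ) {φ : ℝ → ℝ} (hφb : ∀ θ, |φ θ| ≤ 1) (i : ℕ) :
    ∀ ε > 0, ∃ η > 0, ∀ α, 0 < α → α < η → ∀ x, |x| < η → ∀ θ,
      |fn a d φ α i θ x - (qm a)^[i] 0| < ε := by
  induction i with
  | zero => exact fun ε hε => ⟨ε, hε, fun α _ _ x hx θ => by simpa [fn_zero] using hx⟩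
  | succ i ih =>
    intro ε hε
    have hcont : Continuous (qm a) := by unfold qm; fun_prop
    obtain ⟨ε', hε', h⟩ := Metric.continuousAt_iff.1 (hcont.continuousAt (x := (qm a)^[i] 0))
      (ε / 2) (by positivity)
    obtain ⟨η, hη, hη'⟩ := ih ε' hε'
    refine ⟨min η (ε / 2), by positivity, fun α hα hα1 x hx θ => ?_⟩
    have h1 := h (hη' α hα (hα1.trans_le (min_le_left _ _)) x (hx.trans_le (min_le_left _ _)) θ)
    rw [Real.dist_eq] at h1
    have h2 : |α * φ ((d : ℝ) ^ i * θ)| ≤ α := by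
      rw [abs_mul, abs_of_pos hα]
      exact mul_le_of_le_one_right hα.le (hφb _)
    rw [fn_succ, Function.iterate_succ_apply', add_sub_right_comm]
    have h3 := hα1.trans_le (min_le_right _ _)
    linarith [abs_add_le (qm a (fn a d φ α i θ x) - qm a ((qm a)^[i] 0))
      (α * φ ((d : ℝ) ^ i * θ))]

/-- For small `α`, consecutive return times are at least `G` apart. -/
theorem exists_return_gap {a : ℝ} {d : ℕ} (hd : 2 ≤ d) {φ : ℝ → ℝ}
    (hφp : Function.Periodic φ 1) (hφb : ∀ θ, |φ θ| ≤ 1) (β : ℝ) (n₀ : ℕ) {ξ₀ : ℝ} (hξ₀ : 0 < ξ₀)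
    (hcrit : ∀ i : ℕ, 1 ≤ i → (qm a)^[i] 0 ∉ Set.Ioo (-(2 * ξ₀)) (2 * ξ₀)) {C : ℝ} (hC : 0 < C)
    (G : ℕ) :
    ∃ α₁ > 0, ∀ α, 0 < α → α < α₁ →
      (∀ X, Admissible a d φ α β n₀ X → ∀ t ∈ Set.Ico (0 : ℝ) 1, ∀ t' ∈ Set.Ico (0 : ℝ) 1,
        |X t - X t'| ≤ α * C * |t - t'|) →
      ∀ X, Admissible a d φ α β n₀ X →
        Set.MapsTo X (Set.Ico (0 : ℝ) 1)
          (Set.Icc (-(2 * α ^ (0.6 : ℝ))) (2 * α ^ (0.6 : ℝ))) →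
        ∀ θ m n, IsRet a d φ α X θ m → IsRet a d φ α X θ n → m < n → m + G ≤ n := by
  have hall : ∃ η > 0, ∀ i < G, ∀ α, 0 < α → α < η → ∀ x, |x| < η → ∀ θ,
      |fn a d φ α i θ x - (qm a)^[i] 0| < ξ₀ := by
    choose η hη hη' using fun i => exists_shadowing a d hφb i ξ₀ hξ₀
    rcases (Finset.range G).eq_empty_or_nonempty with h | h
    · refine ⟨1, one_pos, fun i hi => ?_⟩
      rw [Finset.range_eq_empty_iff] at h
      omega
    · refine ⟨(Finset.range G).inf' h η, (Finset.lt_inf'_iff h).2 fun i _ => hη i, ?_⟩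
      intro i hi α hα hα1 x hx θ
      have h1 := Finset.inf'_le η (Finset.mem_range.2 hi)
      exact hη' i α hα (hα1.trans_le h1) x (hx.trans_le h1) θ
  obtain ⟨η, hη, hsh⟩ := hall
  have htend : Tendsto (fun α : ℝ => α ^ (0.6 : ℝ)) (nhds 0) (nhds 0) := by
    have := (Real.continuousAt_rpow_const 0 (0.6 : ℝ) (Or.inr (by norm_num))).tendsto
    rwa [Real.zero_rpow (by norm_num)] at this
  have hev : ∀ᶠ α : ℝ in nhds 0, α ^ (0.6 : ℝ) < min ξ₀ (η / (2 * 2)) ∧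
      α < min η (η / (2 * C)) :=
    (htend.eventually (gt_mem_nhds (by positivity))).and (gt_mem_nhds (by positivity))
  obtain ⟨α₁, hα₁, hα₁'⟩ := Metric.eventually_nhds_iff.1 hev
  refine ⟨α₁, hα₁, fun α hα hαlt hlip X hX hXm θ m n hm hn hmn => ?_⟩
  obtain ⟨h1, h2⟩ := hα₁' (show dist α 0 < α₁ by rwa [Real.dist_0_eq_abs, abs_of_pos hα])
  rw [lt_min_iff] at h1 h2
  by_contra! hlt
  obtain ⟨i, rfl⟩ := Nat.exists_eq_add_of_lt hmn
  rcases hn with hn | ⟨-, θ', hθ', hfl, hret⟩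
  · omega
  have hpow : 0 < α ^ (0.6 : ℝ) := Real.rpow_pos_of_pos hα _
  have hnear : |fn a d φ α m θ' (X θ')| < η := by
    have h3 : α * C < η / 2 := by
      have := (lt_div_iff₀ (by positivity)).1 h2.2
      linarith
    rcases hm with rfl | ⟨-, θ'', hθ'', hfl', hret'⟩
    · rw [fn_zero]
      have := abs_le.2 (hXm hθ')
      linarith [h1.2]
    · have h4 : ⌊θ' * (d : ℝ) ^ (m + 0)⌋ = ⌊θ'' * (d : ℝ) ^ (m + 0)⌋ :=
        (floor_cell_mono hd (by omega) hfl).trans hfl'.symm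
      have h5 := abs_iterate_sub_le hd hφp hα.le hC.le hlip hX m 0 hθ' hθ'' h4
      rw [pow_zero, div_one] at h5
      linarith [abs_sub_abs_le_abs_sub (fn a d φ α m θ' (X θ')) (fn a d φ α m θ'' (X θ'')),
        h1.2]
  have h6 := hsh (i + 1) (by omega) α hα h2.1 _ hnear ((d : ℝ) ^ m * θ')
  rw [← fn_add, show i + 1 + m = m + i + 1 by omega] at h6
  refine hcrit (i + 1) (by omega) ?_
  rw [Set.mem_Ioo, ← abs_lt]
  rw [abs_sub_comm] at h6
  linarith [abs_sub_abs_le_abs_sub ((qm a)^[i + 1] 0) (fn a d φ α (m + i + 1) θ' (X θ'))]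

theorem cellConst_isRet (a : ℝ) (d : ℕ) (φ : ℝ → ℝ) (α : ℝ) (X : ℝ → ℝ) (n : ℕ) :
    CellConst d n (IsRet a d φ α X · n) := by
  intro θ θ' h
  simp only [IsRet, h]

/-- The union of the cells of generation `m + s` that meet `{|f_m(θ, X(θ))| < α d^{1-s}}`. -/
def deepCells (a : ℝ) (d : ℕ) (φ : ℝ → ℝ) (α : ℝ) (X : ℝ → ℝ) (m s : ℕ) : Set ℝ :=
  {θ | ∃ θ' ∈ Set.Ico (0 : ℝ) 1, ⌊θ' * (d : ℝ) ^ (m + s)⌋ = ⌊θ * (d : ℝ) ^ (m + s)⌋ ∧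
    |fn a d φ α m θ' (X θ')| < α * (d / (d : ℝ) ^ s)}

theorem cellConst_deepCells (a : ℝ) (d : ℕ) (φ : ℝ → ℝ) (α : ℝ) (X : ℝ → ℝ) (m s : ℕ) :
    CellConst d (m + s) (· ∈ deepCells a d φ α X m s) := by
  intro θ θ' h
  simp only [deepCells, Set.mem_ofPred_eq, h]

/-- The transversality estimate bounds the relative measure of `deepCells` in each cell. -/
theorem measure_cell_inter_deepCells_le {a : ℝ} {d : ℕ} (hd : 2 ≤ d) {φ : ℝ → ℝ}
    (hφp : Function.Periodic φ 1) {α β C : ℝ} (hα : 0 < α) (hC : 0 < C) {n₀ : ℕ}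
    (hlip : ∀ X, Admissible a d φ α β n₀ X → ∀ t ∈ Set.Ico (0 : ℝ) 1, ∀ t' ∈ Set.Ico (0 : ℝ) 1,
      |X t - X t'| ≤ α * C * |t - t'|) {κ ε₀ : ℝ}
    (hdeep : ∀ X : ℝ → ℝ, Admissible a d φ α β n₀ X → ∀ ε : ℝ, 0 ≤ ε → ε < ε₀ →
      volume {θ : ℝ | θ ∈ Set.Ico (0 : ℝ) 1 ∧ |X θ| < α * ε} ≤ ENNReal.ofReal (ε ^ κ))
    {X : ℝ → ℝ} (hX : Admissible a d φ α β n₀ X) (m s : ℕ)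
    (hs : (C + d) / (d : ℝ) ^ s < ε₀) (i : ℤ) :
    volume.restrict (Set.Ico (0 : ℝ) 1)
        ({θ | ⌊θ * (d : ℝ) ^ m⌋ = i} ∩ deepCells a d φ α X m s) ≤
      ENNReal.ofReal (((C + d) / (d : ℝ) ^ s) ^ κ) *
        volume.restrict (Set.Ico (0 : ℝ) 1) {θ | ⌊θ * (d : ℝ) ^ m⌋ = i} := by
  have hpos : (0 : ℝ) < (d : ℝ) ^ m := by positivity
  rw [Measure.restrict_apply' measurableSet_Ico, Measure.restrict_apply' measurableSet_Ico]
  rcases Set.eq_empty_or_nonempty ({θ | ⌊θ * (d : ℝ) ^ m⌋ = i} ∩ Set.Ico (0 : ℝ) 1) with h | h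
  · have : {θ | ⌊θ * (d : ℝ) ^ m⌋ = i} ∩ deepCells a d φ α X m s ∩ Set.Ico (0 : ℝ) 1 ⊆ ∅ := by
      rw [← h]
      exact fun θ hθ => ⟨hθ.1.1, hθ.2⟩
    rw [Set.subset_empty_iff.1 this]
    simp
  obtain ⟨θ₀, hθ₀, hθ₀'⟩ := h
  obtain ⟨j, hj, hfl, -⟩ := exists_cell_index hd m hθ₀'
  obtain rfl : i = j := hθ₀.symm.trans hfl
  set Z : ℝ → ℝ := fun t => fn a d φ α m ((t + j) / (d : ℝ) ^ m) (X ((t + j) / (d : ℝ) ^ m))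
    with hZ
  have hscale : ∀ T : Set ℝ, volume ((fun θ => (d : ℝ) ^ m * θ) ⁻¹' ((fun t => t + -(j : ℝ)) ⁻¹' T))
      = ENNReal.ofReal |((d : ℝ) ^ m)⁻¹| * volume T := by
    intro T
    rw [Real.volume_preimage_mul_left hpos.ne', measure_preimage_add_right]
  set ε := (C + d) / (d : ℝ) ^ s with hε
  calc volume ({θ | ⌊θ * (d : ℝ) ^ m⌋ = (j : ℤ)} ∩ deepCells a d φ α X m s ∩ Set.Ico (0 : ℝ) 1)
      ≤ volume ((fun θ => (d : ℝ) ^ m * θ) ⁻¹' ((fun t => t + -(j : ℝ)) ⁻¹'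
          {t | t ∈ Set.Ico (0 : ℝ) 1 ∧ |Z t| < α * ε})) := by
        refine measure_mono ?_
        rintro θ ⟨⟨h1, θ', hθ', h2, h3⟩, hθ⟩
        obtain ⟨l, -, h4, h5⟩ := exists_cell_index hd m hθ
        obtain rfl : j = l := by exact_mod_cast (show (j : ℤ) = l from (Eq.symm h1).trans h4)
        have h6 : (d : ℝ) ^ m * θ + -(j : ℝ) = θ * (d : ℝ) ^ m - j := by ring
        refine ⟨by simpa only [h6] using h5, ?_⟩
        have h7 : ((d : ℝ) ^ m * θ + -(j : ℝ) + j) / (d : ℝ) ^ m = θ := by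
          field_simp
          ring
        simp only [hZ, h7]
        have h8 := abs_iterate_sub_le hd hφp hα.le hC.le hlip hX m s hθ hθ' h2.symm
        rw [hε, add_div, mul_add]
        linarith [abs_sub_abs_le_abs_sub (fn a d φ α m θ (X θ)) (fn a d φ α m θ' (X θ'))]
    _ = ENNReal.ofReal |((d : ℝ) ^ m)⁻¹| *
          volume {t | t ∈ Set.Ico (0 : ℝ) 1 ∧ |Z t| < α * ε} := hscale _
    _ ≤ ENNReal.ofReal |((d : ℝ) ^ m)⁻¹| * ENNReal.ofReal (ε ^ κ) := by
        gcongr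
        exact hdeep Z (hX.image hd hφp hj) ε (by positivity) hs
    _ = ENNReal.ofReal (ε ^ κ) * volume ((fun θ => (d : ℝ) ^ m * θ) ⁻¹'
          ((fun t => t + -(j : ℝ)) ⁻¹' Set.Ico (0 : ℝ) 1)) := by
        rw [hscale, Real.volume_Ico]
        simp [mul_comm]
    _ ≤ _ := by
        gcongr
        intro θ hθ
        have hθ' : (d : ℝ) ^ m * θ + -(j : ℝ) ∈ Set.Ico (0 : ℝ) 1 := hθ
        have hj' : (j : ℝ) + 1 ≤ (d : ℝ) ^ m := by exact_mod_cast hj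
        have hj0 : (0 : ℝ) ≤ j := by positivity
        refine ⟨?_, ?_, ?_⟩
        · change ⌊θ * (d : ℝ) ^ m⌋ = (j : ℤ)
          rw [Int.floor_eq_iff]
          push_cast
          constructor <;> linarith [hθ'.1, hθ'.2, mul_comm θ ((d : ℝ) ^ m)]
        · have : 0 ≤ (d : ℝ) ^ m * θ := by linarith [hθ'.1]
          exact nonneg_of_mul_nonneg_right this hpos
        · have : (d : ℝ) ^ m * θ < (d : ℝ) ^ m * 1 := by linarith [hθ'.2]
          exact lt_of_mul_lt_mul_left this hpos.le

/-- If the truncated return depth is nonzero, it exceeds the threshold, and the point lies in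
the corresponding deep cells at the return time. -/
theorem qk_eq_zero_or {a : ℝ} {d : ℕ} (hd : 2 ≤ d) {φ : ℝ → ℝ} {α ε₁ : ℝ} (hα : 0 < α)
    {X : ℝ → ℝ} {s₀ : ℕ} (hε₁ : ε₁ < ((d : ℝ) ^ s₀)⁻¹) {θ : ℝ} (hθ : θ ∈ Set.Ico (0 : ℝ) 1)
    (hne : ∀ i, fn a d φ α i θ (X θ) ≠ 0) (k : ℕ) :
    qk a d φ α ε₁ X θ k = 0 ∨ ∃ m, θ ∈ occursAt (IsRet a d φ α X) k m ∧
      (s₀ : ℤ) ≤ qk a d φ α ε₁ X θ k ∧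
      ∀ s : ℕ, (s : ℤ) ≤ qk a d φ α ε₁ X θ k → θ ∈ deepCells a d φ α X m s := by
  classical
  have hd1 : (1 : ℝ) < d := by exact_mod_cast (by omega : 1 < d)
  have hd0 : (0 : ℝ) < d := by linarith
  unfold qk
  split_ifs with h1 h2
  · right
    set q := ⌈Real.logb d (α / |fn a d φ α (nk a d φ α X θ k) θ (X θ)|)⌉ with hq
    have hcard : ∀ hf : (Set.ofPred (IsRet a d φ α X θ)).Finite, k < hf.toFinset.card := by
      intro hf
      rcases h1 with h | h
      · exact absurd hf h
      · rwa [← Set.ncard_eq_toFinset_card _ hf]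
    refine ⟨nk a d φ α X θ k, ⟨Nat.nth_mem _ hcard, ?_⟩, ?_, fun s hs => ⟨θ, hθ, rfl, ?_⟩⟩
    · rw [nk]
      convert Nat.count_nth hcard
    · have h3 : (d : ℝ) ^ (-(q - 1)) < (d : ℝ) ^ (-(s₀ : ℤ)) := by
        rw [zpow_neg _ (s₀ : ℤ), zpow_natCast]
        exact h2.trans hε₁
      have := (zpow_lt_zpow_iff_right₀ hd1).1 h3
      omega
    · set y := |fn a d φ α (nk a d φ α X θ k) θ (X θ)| with hy
      have hy0 : 0 < y := abs_pos.2 (hne _)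
      have h3 : ((q - 1 : ℤ) : ℝ) < Real.logb d (α / y) := by
        have := Int.ceil_lt_add_one (Real.logb d (α / y))
        push_cast
        linarith
      rw [Real.lt_logb_iff_rpow_lt hd1 (by positivity), Real.rpow_intCast,
        lt_div_iff₀ hy0] at h3
      have h4 : (d : ℝ) ^ ((s : ℤ) - 1) ≤ (d : ℝ) ^ (q - 1) :=
        zpow_le_zpow_right₀ hd1.le (by omega)
      have h5 : (d : ℝ) ^ ((s : ℤ) - 1) * y < α :=
        (mul_le_mul_of_nonneg_right h4 hy0.le).trans_lt h3
      rw [zpow_sub_one₀ hd0.ne', zpow_natCast] at h5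
      rw [← mul_div_assoc, lt_div_iff₀ (by positivity)]
      calc y * (d : ℝ) ^ s = (d : ℝ) ^ s * (d : ℝ)⁻¹ * y * d := by field_simp
        _ < α * d := by gcongr
  · exact Or.inl rfl
  · exact Or.inl rfl

/-! ### Choice of constants -/

theorem exists_forall_numeric_bound {D κ c B : ℝ} (hD : 1 < D) (hκ : 0 < κ) (hc : 0 < c)
    (hB : 0 < B) {G : ℕ} (hG : c ≤ G) :
    ∃ K₀ : ℕ, ∀ K : ℕ, K₀ ≤ K → ∀ M : ℕ, M = Nat.sqrt K + 1 →
      ((M * M : ℕ) : ℝ) * (B / D ^ (G * M + 1)) ^ κ +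
        M * ((D ^ (κ * c / 6)) ^ M / D ^ (κ / 2 * (c * K / M))) ≤
      D ^ (-(κ * c * Real.sqrt K) / 6) := by
  have hD0 : 0 < D := by linarith
  set y : ℝ := D ^ (-(κ * c / 6)) with hy
  have hy0 : 0 < y := Real.rpow_pos_of_pos hD0 _
  have hy1 : y < 1 := Real.rpow_lt_one_of_one_lt_of_neg hD (by
    have : 0 < κ * c / 6 := by positivity
    linarith)
  set E : ℝ := B ^ κ + D ^ (κ * c) with hE
  have hyM : ∀ M : ℕ, y ^ M = D ^ (-(κ * c / 6) * M) := by
    intro M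
    rw [hy, ← Real.rpow_natCast, ← Real.rpow_mul hD0.le]
  have hlim : Tendsto (fun n : ℕ => E * ((n : ℝ) ^ 2 * y ^ n)) atTop (nhds 0) := by
    have := (tendsto_pow_const_mul_const_pow_of_abs_lt_one 2
      (by rwa [abs_of_pos hy0] : |y| < 1)).const_mul E
    rwa [mul_zero] at this
  obtain ⟨M₀, hM₀⟩ := eventually_atTop.1 (hlim.eventually (ge_mem_nhds one_pos))
  refine ⟨M₀ * M₀, fun K hK M hM => ?_⟩
  have hMM : M₀ ≤ M := by
    have := Nat.le_sqrt.2 hK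
    omega
  have hMpos : 1 ≤ M := by omega
  have hM1 : (1 : ℝ) ≤ M := by exact_mod_cast hMpos
  have hMK : (K : ℝ) ≤ (M : ℝ) ^ 2 := by
    have : K ≤ M ^ 2 := by rw [hM, sq]; exact (Nat.lt_succ_sqrt K).le
    exact_mod_cast this
  have hKM : (M : ℝ) - 2 ≤ K / M := by
    have h1 : Nat.sqrt K * Nat.sqrt K ≤ K := Nat.sqrt_le K
    have h2 : ((M : ℝ) - 1) * (M - 1) ≤ K := by
      have h3 : (M : ℝ) - 1 = (Nat.sqrt K : ℕ) := by rw [hM]; push_cast; ring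
      rw [h3]
      exact_mod_cast h1
    rw [le_div_iff₀ (by linarith)]
    nlinarith
  have hsqrt : Real.sqrt K ≤ M := by
    rw [Real.sqrt_le_left (by linarith)]
    exact hMK
  have hκc : 0 < κ * c := by positivity
  have h1 : (B / D ^ (G * M + 1)) ^ κ ≤ B ^ κ * (y ^ M * y ^ M) := by
    rw [Real.div_rpow hB.le (by positivity), div_eq_mul_inv, hyM, ← Real.rpow_add hD0,
      ← Real.rpow_natCast, ← Real.rpow_mul hD0.le, ← Real.rpow_neg hD0.le]
    gcongr
    · exact hD.le
    · push_cast
      have h2 : κ * c * M ≤ κ * (G * M) := by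
        rw [mul_assoc]
        gcongr
      nlinarith [mul_pos hκc (by linarith : (0 : ℝ) < M)]
  have h2 : (D ^ (κ * c / 6)) ^ M / D ^ (κ / 2 * (c * K / M)) ≤
      D ^ (κ * c) * (y ^ M * y ^ M) := by
    rw [hyM, ← Real.rpow_add hD0, ← Real.rpow_add hD0, ← Real.rpow_natCast,
      ← Real.rpow_mul hD0.le, ← Real.rpow_sub hD0]
    refine Real.rpow_le_rpow_of_exponent_le hD.le ?_
    have h3 : κ / 2 * (c * K / M) = κ * c / 2 * (K / M) := by ring
    rw [h3]
    nlinarith [mul_le_mul_of_nonneg_left hKM (by positivity : 0 ≤ κ * c / 2)]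
  calc ((M * M : ℕ) : ℝ) * (B / D ^ (G * M + 1)) ^ κ +
        M * ((D ^ (κ * c / 6)) ^ M / D ^ (κ / 2 * (c * K / M)))
      ≤ (M : ℝ) ^ 2 * (B ^ κ * (y ^ M * y ^ M)) +
          (M : ℝ) ^ 2 * (D ^ (κ * c) * (y ^ M * y ^ M)) := by
        gcongr
        · push_cast
          exact (sq _).ge
        · nlinarith
    _ = E * ((M : ℝ) ^ 2 * y ^ M) * y ^ M := by rw [hE]; ring
    _ ≤ 1 * y ^ M := by
        gcongr
        exact hM₀ M hMM
    _ = D ^ (-(κ * c / 6) * M) := by rw [one_mul, hyM]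
    _ ≤ D ^ (-(κ * c * Real.sqrt K) / 6) := by
        refine Real.rpow_le_rpow_of_exponent_le hD.le ?_
        nlinarith [mul_le_mul_of_nonneg_left hsqrt hκc.le]

theorem sum_weight_mul_le {D κ B : ℝ} (hD : 1 < D) (hκ : 0 < κ) (hB : 0 < B) (s₀ S : ℕ) :
    ∑ s ∈ Finset.Icc s₀ S,
        ENNReal.ofReal (D ^ (κ / 2 * s)) * ENNReal.ofReal ((B / D ^ s) ^ κ) ≤
      ENNReal.ofReal (B ^ κ * ((D ^ (-(κ / 2))) ^ s₀ / (1 - D ^ (-(κ / 2))))) := by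
  have hD0 : 0 < D := by linarith
  set x : ℝ := D ^ (-(κ / 2)) with hx
  have hx0 : 0 < x := Real.rpow_pos_of_pos hD0 _
  have hx1 : x < 1 := Real.rpow_lt_one_of_one_lt_of_neg hD (by linarith)
  have hterm : ∀ s : ℕ, ENNReal.ofReal (D ^ (κ / 2 * s)) * ENNReal.ofReal ((B / D ^ s) ^ κ) =
      ENNReal.ofReal (B ^ κ * x ^ s) := by
    intro s
    rw [← ENNReal.ofReal_mul (by positivity), Real.div_rpow hB.le (by positivity), hx,
      ← Real.rpow_natCast (D ^ (-(κ / 2))), ← Real.rpow_mul hD0.le, ← Real.rpow_natCast D,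
      ← Real.rpow_mul hD0.le, div_eq_mul_inv (B ^ κ), ← Real.rpow_neg hD0.le, mul_left_comm,
      ← Real.rpow_add hD0]
    congr 3
    ring
  simp only [hterm]
  rw [← ENNReal.ofReal_sum_of_nonneg fun _ _ => by positivity, ← Finset.mul_sum]
  refine ENNReal.ofReal_le_ofReal (mul_le_mul_of_nonneg_left ?_ (by positivity))
  rw [← Finset.Ico_add_one_right_eq_Icc]
  exact geom_sum_Ico_le_of_lt_one hx0.le hx1

theorem exists_truncation_level {D κ B δ ε₀ : ℝ} (hD : 1 < D) (hκ : 0 < κ) (hδ : 0 < δ)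
    (hε₀ : 0 < ε₀) :
    ∃ s₀ : ℕ, B ^ κ * ((D ^ (-(κ / 2))) ^ s₀ / (1 - D ^ (-(κ / 2)))) ≤ δ ∧
      B / D ^ s₀ < ε₀ := by
  have hD0 : 0 < D := by linarith
  set x : ℝ := D ^ (-(κ / 2)) with hx
  have hx0 : 0 < x := Real.rpow_pos_of_pos hD0 _
  have hx1 : x < 1 := Real.rpow_lt_one_of_one_lt_of_neg hD (by linarith)
  have h1 : Tendsto (fun s : ℕ => B ^ κ * (x ^ s / (1 - x))) atTop (nhds 0) := by
    have := ((tendsto_pow_atTop_nhds_zero_of_lt_one hx0.le hx1).div_const (1 - x)).const_mul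
      (B ^ κ)
    rwa [zero_div, mul_zero] at this
  have h2 : Tendsto (fun s : ℕ => B / D ^ s) atTop (nhds 0) :=
    (tendsto_pow_atTop_atTop_of_one_lt hD).const_div_atTop B
  exact ((h1.eventually (ge_mem_nhds hδ)).and (h2.eventually (gt_mem_nhds hε₀))).exists

/-- large deviations for deep returns. Let `κ, ε₀` be as in the
transversality estimate. For any `c > 0`, if the truncation parameter `ε₁ ∈ (0, ε₀)` is small
enough and `α` is small enough, then for all large `K`:
`|E_K(c)| = |{θ ∈ [0,1) ∖ Q : ∑_{k=0}^{K} q_k(θ) ≥ cK}| ≤ d^{-κ c √K / 6}`. -/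
theorem large_deviation_deep_returns
    (a : ℝ) (ha : a ∈ Set.Ioo (1 : ℝ) 2) (hpre : StrictlyPreperiodic a)
    (d : ℕ) (hd : 2 ≤ d)
    (φ : ℝ → ℝ) (hφa : ∀ x : ℝ, AnalyticAt ℝ φ x) (hφp : Function.Periodic φ 1)
    (hφnc : ∃ s t : ℝ, φ s ≠ φ t) (hφb : ∀ θ : ℝ, |φ θ| ≤ 1)
    (β : ℝ) (hβ1 : 1 < β) (hβ2 : β < |(-1 - Real.sqrt (1 + 4 * a)) / 2|)
    (hβmap : ∀ x ∈ Set.Icc (-β) β, qm a x ∈ Set.Ioo (-β) β)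
    (hβder : ∀ x : ℝ, β ≤ |x| → 2 * β ≤ |deriv (qm a) x|)
    (n₀ : ℕ)
    (hdom : ∃ C₁ R₁ : ℝ, 0 < C₁ ∧ R₁ ∈ Set.Ioo (0 : ℝ) 2 ∧ ∃ α₁ > 0, ∀ α : ℝ, 0 < α → α < α₁ →
      ∀ θ x : ℝ, x ∈ Set.Icc (-β) β → ∀ k : ℕ,
        |deriv (fun y => fn a d φ α k θ y) x| ≤ C₁ * R₁ ^ k ∧
        (n₀ ≤ k → |deriv (fun y => fn a d φ α k θ y) x| ≤ R₁ ^ k ∧ R₁ ^ k ≤ (d : ℝ) ^ k / 6))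
    (ξ₀ : ℝ) (hξ₀ : 0 < ξ₀)
    (hcrit : ∀ i : ℕ, 1 ≤ i → (qm a)^[i] 0 ∉ Set.Ioo (-(2 * ξ₀)) (2 * ξ₀))
    (κ ε₀ : ℝ) (hκ : 0 < κ) (hε₀ : 0 < ε₀)
    (hdeep : ∃ α₁ > 0, ∀ α : ℝ, 0 < α → α < α₁ →
      ∀ X : ℝ → ℝ, Admissible a d φ α β n₀ X →
        ∀ ε : ℝ, 0 ≤ ε → ε < ε₀ →
          volume {θ : ℝ | θ ∈ Set.Ico (0 : ℝ) 1 ∧ |X θ| < α * ε} ≤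
            ENNReal.ofReal (ε ^ κ)) :
    ∀ c : ℝ, 0 < c → ∃ ε₁' > 0, ∀ ε₁ : ℝ, 0 < ε₁ → ε₁ < ε₁' → ε₁ < ε₀ →
      ∃ α₀ > 0, ∀ α : ℝ, 0 < α → α < α₀ → α ≤ ξ₀ →
        ∀ X : ℝ → ℝ, Admissible a d φ α β n₀ X →
          Set.MapsTo X (Set.Ico (0 : ℝ) 1)
            (Set.Icc (-(2 * α ^ (0.6 : ℝ))) (2 * α ^ (0.6 : ℝ))) →
          ∃ K₀ : ℕ, ∀ K : ℕ, K₀ ≤ K →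
            volume {θ : ℝ | θ ∈ Set.Ico (0 : ℝ) 1 ∧
                (∀ i : ℕ, fn a d φ α i θ (X θ) ≠ 0) ∧
                c * K ≤ ((∑ k ∈ Finset.range (K + 1), qk a d φ α ε₁ X θ k : ℤ) : ℝ)} ≤
              ENNReal.ofReal ((d : ℝ) ^ (-(κ * c * Real.sqrt K) / 6)) := by
  intro c hc
  have hd1 : (1 : ℝ) < d := by exact_mod_cast (by omega : 1 < d)
  have hd0 : (0 : ℝ) < d := by linarith
  obtain ⟨C₁, R₁, hC₁, hR₁, α₁, hα₁, hdom⟩ := hdom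
  obtain ⟨α₂, hα₂, hdeep⟩ := hdeep
  obtain ⟨C, hC, α₃, hα₃, hlip⟩ := exists_admissible_lipschitz hd hφa hφp hφb
    (by linarith : 0 ≤ β) hβmap n₀ hC₁ hR₁ hα₁
    fun α h1 h2 θ x hx k => (hdom α h1 h2 θ x hx k).1
  set δ : ℝ := (d : ℝ) ^ (κ * c / 6) - 1 with hδ
  have hδ0 : 0 < δ := sub_pos.2 (Real.one_lt_rpow hd1 (by positivity))
  obtain ⟨s₀, hs₀, hs₀'⟩ := exists_truncation_level (B := C + d) hd1 hκ hδ0 hε₀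
  refine ⟨((d : ℝ) ^ s₀)⁻¹, by positivity, fun ε₁ _ hε₁ _ => ?_⟩
  set G := ⌈c⌉₊ with hGdef
  have hGc : c ≤ G := Nat.le_ceil c
  have hG : 1 ≤ G := Nat.one_le_ceil_iff.2 hc
  obtain ⟨α₄, hα₄, hgap⟩ := exists_return_gap hd hφp hφb β n₀ hξ₀ hcrit hC G
  refine ⟨min (min α₂ α₃) α₄, by positivity, fun α hα hαlt _ X hX hXm => ?_⟩
  simp only [lt_min_iff] at hαlt
  obtain ⟨⟨hαlt₂, hαlt₃⟩, hαlt₄⟩ := hαlt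
  have hlip := hlip α hα hαlt₃
  have hgap := hgap α hα hαlt₄ hlip X hX hXm
  have hdeep := hdeep α hα hαlt₂
  obtain ⟨K₁, hK₁⟩ := exists_forall_numeric_bound hd1 hκ hc (by positivity : 0 < C + (d : ℝ)) hGc
  refine ⟨max K₁ (s₀ * s₀), fun K hK => ?_⟩
  obtain ⟨M, hM⟩ : ∃ M, M = Nat.sqrt K + 1 := ⟨_, rfl⟩
  have hnum := hK₁ K ((le_max_left _ _).trans hK) M hM
  have hM0 : 0 < M := by omega
  have hs₀S : s₀ ≤ G * M + 1 := by
    have h1 : s₀ ≤ Nat.sqrt K := Nat.le_sqrt.2 ((le_max_right _ _).trans hK)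
    have h2 : 1 * M ≤ G * M := Nat.mul_le_mul_right M hG
    omega
  have hKM : K + 1 ≤ M * M := by rw [hM]; exact Nat.lt_succ_sqrt K
  set E : Set ℝ := {θ | θ ∈ Set.Ico (0 : ℝ) 1 ∧ ∀ i, fn a d φ α i θ (X θ) ≠ 0} with hE
  set q : ℝ → ℕ → ℕ := fun θ k => (qk a d φ α ε₁ X θ k).toNat with hq
  have hqE : ∀ θ ∈ E, ∀ k, q θ k = 0 ∨ ∃ m, θ ∈ occursAt (IsRet a d φ α X) k m ∧ s₀ ≤ q θ k ∧
      ∀ s ≤ q θ k, θ ∈ deepCells a d φ α X m s := by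
    intro θ hθ k
    rcases qk_eq_zero_or hd hα hε₁ hθ.1 hθ.2 k with h | ⟨m, hm, h1, h2⟩
    · exact Or.inl (by simp [hq, h])
    · exact Or.inr ⟨m, hm, by simp only [hq]; omega, fun s hs => h2 s (by
        simp only [hq] at hs; omega)⟩
  set μ : Measure ℝ := volume.restrict (Set.Ico (0 : ℝ) 1) with hμ
  have hprob : IsProbabilityMeasure μ := ⟨by simp [hμ]⟩
  have hA : ∀ m s, s₀ ≤ s → ∀ i : ℤ,
      μ ({θ | ⌊θ * (d : ℝ) ^ m⌋ = i} ∩ deepCells a d φ α X m s) ≤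
        ENNReal.ofReal (((C + d) / (d : ℝ) ^ s) ^ κ) * μ {θ | ⌊θ * (d : ℝ) ^ m⌋ = i} := by
    intro m s hs i
    refine measure_cell_inter_deepCells_le hd hφp hα hC hlip hdeep hX m s (lt_of_le_of_lt ?_ hs₀') i
    gcongr
    exact hd1.le
  have hmain := measure_depth_sum_le hd (cellConst_isRet a d φ α X) hgap
    (cellConst_deepCells a d φ α X) hA (by positivity : 0 ≤ κ / 2) hM0 le_rfl hs₀S
    ((sum_weight_mul_le hd1 hκ (by positivity : 0 < C + (d : ℝ)) s₀ (G * M)).trans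
      (ENNReal.ofReal_le_ofReal hs₀)) hqE (c * K)
  calc volume {θ : ℝ | θ ∈ Set.Ico (0 : ℝ) 1 ∧ (∀ i : ℕ, fn a d φ α i θ (X θ) ≠ 0) ∧
          c * K ≤ ((∑ k ∈ Finset.range (K + 1), qk a d φ α ε₁ X θ k : ℤ) : ℝ)}
      ≤ μ {θ | θ ∈ E ∧ c * K ≤ ((∑ k ∈ Finset.range (M * M), q θ k : ℕ) : ℝ)} := by
        rw [hμ, Measure.restrict_apply' measurableSet_Ico]
        refine measure_mono ?_
        rintro θ ⟨h1, h2, h3⟩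
        refine ⟨⟨⟨h1, h2⟩, h3.trans ?_⟩, h1⟩
        have h4 : ∑ k ∈ Finset.range (K + 1), qk a d φ α ε₁ X θ k ≤
            ((∑ k ∈ Finset.range (M * M), q θ k : ℕ) : ℤ) := by
          calc ∑ k ∈ Finset.range (K + 1), qk a d φ α ε₁ X θ k
              ≤ ∑ k ∈ Finset.range (K + 1), (q θ k : ℤ) :=
                Finset.sum_le_sum fun k _ => Int.self_le_toNat _
            _ ≤ ∑ k ∈ Finset.range (M * M), (q θ k : ℤ) :=
                Finset.sum_le_sum_of_subset_of_nonneg (Finset.range_mono hKM)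
                  fun _ _ _ => Int.natCast_nonneg _
            _ = _ := by push_cast; rfl
        exact_mod_cast h4
    _ ≤ _ := hmain
    _ = ENNReal.ofReal (((M * M : ℕ) : ℝ) * ((C + d) / (d : ℝ) ^ (G * M + 1)) ^ κ +
        M * (((d : ℝ) ^ (κ * c / 6)) ^ M / (d : ℝ) ^ (κ / 2 * (c * K / M)))) := by
        have h1 : 1 + ENNReal.ofReal δ = ENNReal.ofReal ((d : ℝ) ^ (κ * c / 6)) := by
          rw [← ENNReal.ofReal_one, ← ENNReal.ofReal_add zero_le_one hδ0.le, hδ]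
          congr 1
          ring
        rw [h1, ← ENNReal.ofReal_pow (by positivity), ← ENNReal.ofReal_div_of_pos (by positivity),
          ← ENNReal.ofReal_natCast, ← ENNReal.ofReal_natCast, ← ENNReal.ofReal_mul (by positivity),
          ← ENNReal.ofReal_mul (by positivity), ← ENNReal.ofReal_add (by positivity)
            (by positivity)]
    _ ≤ ENNReal.ofReal ((d : ℝ) ^ (-(κ * c * Real.sqrt K) / 6)) :=
        ENNReal.ofReal_le_ofReal hnum
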